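/- Let H and G be finitely generated groups such that for every finite-index normal subgroup H₀ of H every group homomorphism H₀ → (ℝ,+) is trivial, and for every finite-index normal subgroup G₀ of G every group homomorphism G₀ → (ℝ,+) is trivial. Then for any C¹ action ρ of H × G on the circle, either the kernel of the homomorphism h ↦ ρ(h,1) has finite index in H, or the kernel of the homomorphism g ↦ ρ(1,g) has finite index in G (i.e. the induced action of one of the two factors factors through a finite group). -/

import Mathlib

open MeasureTheory

/-- The group of self-homeomorphisms of the circle `S¹ = ℝ/ℤ`,
with `f * g = f ∘ g`. -/
noncomputable instance : Group (UnitAddCircle ≃ₜ UnitAddCircle) where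
  mul f g := g.trans f
  one := Homeomorph.refl _
  inv := Homeomorph.symm
  mul_assoc _ _ _ := Homeomorph.ext fun _ => rfl
  one_mul _ := Homeomorph.ext fun _ => rfl
  mul_one _ := Homeomorph.ext fun _ => rfl
  inv_mul_cancel a := Homeomorph.ext a.symm_apply_apply

/-- `F : ℝ → ℝ` is a `C¹` lift of the circle homeomorphism `f`: it is `C¹` with
nowhere-vanishing derivative, commutes with the deck transformation up to sign,
and descends to `f` on `ℝ/ℤ`. -/
def IsC1Lift (f : UnitAddCircle ≃ₜ UnitAddCircle) (F : ℝ → ℝ) : Prop :=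
  ContDiff ℝ 1 F ∧ (∀ x : ℝ, deriv F x ≠ 0) ∧
    ((∀ x : ℝ, F (x + 1) = F x + 1) ∨ (∀ x : ℝ, F (x + 1) = F x - 1)) ∧
    ∀ x : ℝ, f (x : UnitAddCircle) = ((F x : ℝ) : UnitAddCircle)

/-- A `C¹` action of a group `Γ` on the circle: a homomorphism into the
self-homeomorphisms of the circle all of whose values admit `C¹` lifts. -/
def IsC1Action {Γ : Type*} [Group Γ] (ρ : Γ →* (UnitAddCircle ≃ₜ UnitAddCircle)) : Prop :=
  ∀ γ : Γ, ∃ F : ℝ → ℝ, IsC1Lift (ρ γ) F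

/-- `F : ℝ → ℝ` is an orientation-preserving `C¹` lift of the circle
homeomorphism `f`: it is `C¹` with everywhere positive derivative,
satisfies `F (x+1) = F x + 1` and descends to `f` on `ℝ/ℤ`. -/
def IsOPC1Lift (f : UnitAddCircle ≃ₜ UnitAddCircle) (F : ℝ → ℝ) : Prop :=
  ContDiff ℝ 1 F ∧ (∀ x : ℝ, 0 < deriv F x) ∧
    (∀ x : ℝ, F (x + 1) = F x + 1) ∧
    ∀ x : ℝ, f (x : UnitAddCircle) = ((F x : ℝ) : UnitAddCircle)

/-- `F : ℝ → ℝ` is an orientation-preserving (topological) lift of the circle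
homeomorphism `f`: continuous, strictly increasing, satisfies
`F (x+1) = F x + 1`, and descends to `f` on `ℝ/ℤ`. -/
def IsOPLift (f : UnitAddCircle ≃ₜ UnitAddCircle) (F : ℝ → ℝ) : Prop :=
  Continuous F ∧ StrictMono F ∧
    (∀ x : ℝ, F (x + 1) = F x + 1) ∧
    ∀ x : ℝ, f (x : UnitAddCircle) = ((F x : ℝ) : UnitAddCircle)

open Filter Topology Asymptotics in
/-- Local **Thurston stability** in dimension one. -/
theorem eventually_fixed_of_hasStrictDerivAt_one {Γ : Type*} [Group Γ] {S : Finset Γ}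
    (hS : Subgroup.closure (S : Set Γ) = ⊤) (htriv : ∀ φ : Γ →* Multiplicative ℝ, φ = 1)
    {ψ : Γ → ℝ → ℝ} (hmul : ∀ a b x, ψ (a * b) x = ψ a (ψ b x)) (hone : ∀ x, ψ 1 x = x)
    {p : ℝ} (hp : ∀ γ, ψ γ p = p) (hd : ∀ γ, HasStrictDerivAt (ψ γ) 1 p) :
    ∀ᶠ x in 𝓝 p, ∀ γ, ψ γ x = x := by
  classical
  set M : ℝ → ℝ := fun x => ∑ s ∈ S, |ψ s x - x| with hM
  have hMnn : ∀ x, 0 ≤ M x := fun x => Finset.sum_nonneg fun _ _ => abs_nonneg _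
  have hM0 : ∀ x, M x = 0 → ∀ γ, ψ γ x = x := by
    intro x hx γ
    have hs : ∀ s ∈ S, ψ s x = x := by
      intro s hs
      have := (Finset.sum_eq_zero_iff_of_nonneg (fun _ _ => abs_nonneg _)).1 hx s hs
      exact sub_eq_zero.1 (abs_eq_zero.1 this)
    have hγ : γ ∈ Subgroup.closure (S : Set Γ) := hS ▸ Subgroup.mem_top γ
    induction hγ using Subgroup.closure_induction with
    | mem s h => exact hs s h
    | one => exact hone x
    | mul a b _ _ ha hb => rw [hmul, hb, ha]
    | inv a _ ha => rw [← ha, ← hmul, inv_mul_cancel, hone, ha]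
  by_contra hcon
  have hfreq : ∃ᶠ x in 𝓝 p, M x ≠ 0 := fun h =>
    hcon (h.mono fun x hx => hM0 x (not_not.1 hx))
  have hne : NeBot (𝓝 p ⊓ 𝓟 {x | M x ≠ 0}) := frequently_mem_iff_neBot.1 hfreq
  set 𝓕 : Ultrafilter ℝ := Ultrafilter.of (𝓝 p ⊓ 𝓟 {x | M x ≠ 0}) with h𝓕
  have hle : (𝓕 : Filter ℝ) ≤ 𝓝 p := (Ultrafilter.of_le _).trans inf_le_left
  have hMF : ∀ᶠ x in (𝓕 : Filter ℝ), M x ≠ 0 :=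
    ((Ultrafilter.of_le _).trans inf_le_right) (mem_principal_self _)
  set u : Γ → ℝ → ℝ := fun γ x => (ψ γ x - x) / M x with hu
  have hadd : ∀ a b, (fun x => u (a * b) x - u a x - u b x) =o[(𝓕 : Filter ℝ)] u b := by
    intro a b
    have h1 := (hd a).hasStrictFDerivAt.isLittleO
    have h2 : Tendsto (fun x => (ψ b x, x)) (𝓝 p) (𝓝 (p, p)) := by
      have := (hd b).hasDerivAt.continuousAt.tendsto
      rw [hp b] at this
      exact this.prodMk_nhds tendsto_id
    have h3 := ((h1.comp_tendsto h2).mono hle).mul_isBigO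
      (isBigO_refl (fun x => (M x)⁻¹) (𝓕 : Filter ℝ))
    refine h3.congr (fun x => ?_) (fun x => ?_)
    · simp only [Function.comp, hu, hmul, ContinuousLinearMap.toSpanSingleton_apply, smul_eq_mul]
      ring
    · simp only [Function.comp, hu]
      ring
  have hbd : ∀ γ, u γ =O[(𝓕 : Filter ℝ)] (fun _ => (1 : ℝ)) := by
    intro γ
    have hγ : γ ∈ Subgroup.closure (S : Set Γ) := hS ▸ Subgroup.mem_top γ
    induction hγ using Subgroup.closure_induction with
    | mem s h =>
      refine IsBigO.of_bound 1 (Eventually.of_forall fun x => ?_)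
      simp only [hu, norm_div, Real.norm_eq_abs, abs_of_nonneg (hMnn x), abs_one, mul_one]
      exact div_le_one_of_le₀
        (Finset.single_le_sum (f := fun s => |ψ s x - x|) (fun _ _ => abs_nonneg _) h) (hMnn x)
    | one =>
      refine (isBigO_zero _ _).congr_left fun x => ?_
      simp [hu, hone]
    | mul a b _ _ ha hb =>
      refine (((((hadd a b).isBigO).trans hb).add ha).add hb).congr_left fun x => ?_
      ring
    | inv a _ ha =>
      refine (((((hadd a⁻¹ a).isBigO).trans ha).add ha)).neg_left.congr_left fun x => ?_
      have : u 1 x = 0 := by simp [hu, hone]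
      rw [inv_mul_cancel, this]
      ring
  have hlim : ∀ γ, ∃ L, Tendsto (u γ) 𝓕 (𝓝 L) := by
    intro γ
    obtain ⟨C, hC⟩ := (hbd γ).bound
    have hK : Set.Icc (-C) C ∈ (𝓕.map (u γ) : Ultrafilter ℝ) := by
      rw [Ultrafilter.mem_map]
      filter_upwards [hC] with x hx
      simpa [abs_le] using hx
    obtain ⟨L, -, hL⟩ := isCompact_Icc.ultrafilter_le_nhds' _ hK
    exact ⟨L, hL⟩
  choose L hL using hlim
  have hLadd : ∀ a b, L (a * b) = L a + L b := by
    intro a b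
    have h1 := (isLittleO_one_iff ℝ).1 ((hadd a b).trans_isBigO (hbd b))
    have h2 := tendsto_nhds_unique h1 (((hL (a * b)).sub (hL a)).sub (hL b))
    linarith
  let φ : Γ →* Multiplicative ℝ := MonoidHom.mk' (fun γ => Multiplicative.ofAdd (L γ))
    (fun a b => by rw [hLadd, ofAdd_add])
  have hL0 : ∀ γ, L γ = 0 := fun γ =>
    Multiplicative.ofAdd.injective (DFunLike.congr_fun (htriv φ) γ)
  have hsum : Tendsto (fun x => ∑ s ∈ S, |u s x|) 𝓕 (𝓝 (∑ s ∈ S, |L s|)) :=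
    tendsto_finsetSum _ fun s _ => (hL s).abs
  have hsum1 : (fun x => ∑ s ∈ S, |u s x|) =ᶠ[(𝓕 : Filter ℝ)] fun _ => 1 := by
    filter_upwards [hMF] with x hx
    simp only [hu, abs_div, abs_of_nonneg (hMnn x), ← Finset.sum_div]
    exact div_self hx
  have := tendsto_nhds_unique (hsum.congr' hsum1) tendsto_const_nhds
  simp [hL0] at this

open Topology in
theorem fixed_of_contDiff_of_fixed_point {Γ : Type*} [Group Γ] (hfg : Group.FG Γ)
    (htriv : ∀ φ : Γ →* Multiplicative ℝ, φ = 1)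
    {ψ : Γ → ℝ → ℝ} (hmul : ∀ a b x, ψ (a * b) x = ψ a (ψ b x)) (hone : ∀ x, ψ 1 x = x)
    (hC : ∀ γ, ContDiff ℝ 1 (ψ γ)) (hpos : ∀ γ x, 0 < deriv (ψ γ) x)
    {p : ℝ} (hp : ∀ γ, ψ γ p = p) (γ : Γ) (x : ℝ) : ψ γ x = x := by
  obtain ⟨S, hS⟩ := hfg.out
  have hdiff : ∀ γ, Differentiable ℝ (ψ γ) := fun γ => (hC γ).differentiable one_ne_zero
  have hclosed : IsClosed {x | ∀ γ, ψ γ x = x} := by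
    simp only [Set.ofPred_forall]
    exact isClosed_iInter fun γ => isClosed_eq (hC γ).continuous continuous_id
  have hopen : IsOpen {x | ∀ γ, ψ γ x = x} := by
    refine isOpen_iff_mem_nhds.2 fun q (hq : ∀ γ, ψ γ q = q) => ?_
    have hd1 : ∀ γ, deriv (ψ γ) q = 1 := by
      have hchain : ∀ a b, deriv (ψ (a * b)) q = deriv (ψ a) q * deriv (ψ b) q := by
        intro a b
        have h : ψ (a * b) = ψ a ∘ ψ b := funext (hmul a b)
        rw [h, deriv_comp q (hdiff a _) (hdiff b _), hq b]
      let φ : Γ →* Multiplicative ℝ := MonoidHom.mk'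
        (fun γ => Multiplicative.ofAdd (Real.log (deriv (ψ γ) q)))
        (fun a b => by
          rw [hchain, Real.log_mul (hpos a q).ne' (hpos b q).ne', ofAdd_add])
      intro γ
      have h0 : Real.log (deriv (ψ γ) q) = 0 :=
        Multiplicative.ofAdd.injective (DFunLike.congr_fun (htriv φ) γ)
      exact Real.eq_one_of_pos_of_log_eq_zero (hpos γ q) h0
    refine eventually_fixed_of_hasStrictDerivAt_one hS htriv hmul hone hq fun γ => ?_
    have := (hC γ).contDiffAt.hasStrictDerivAt (x := q) one_ne_zero
    rwa [hd1] at this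
  have huniv := IsClopen.eq_univ ⟨hclosed, hopen⟩ ⟨p, hp⟩
  have : x ∈ {x | ∀ γ, ψ γ x = x} := huniv ▸ Set.mem_univ x
  exact this γ

theorem MonoidHom.finiteIndex_ker_of_forall_hom_real_trivial {Γ A : Type*} [Group Γ]
    [AddCommGroup A] (hfg : Group.FG Γ) (htriv : ∀ φ : Γ →* Multiplicative ℝ, φ = 1)
    (χ : Γ →* Multiplicative A) : χ.ker.FiniteIndex := by
  have : Group.FG χ.range := inferInstance
  have : AddGroup.FG (Additive χ.range) := inferInstance
  obtain ⟨n, ι, _, q, hq, e, ⟨E⟩⟩ := AddCommGroup.equiv_free_prod_directSum_zmod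
    (Additive χ.range)
  rcases n with - | n
  · have : ∀ i, NeZero (q i ^ e i) := fun i => ⟨pow_ne_zero _ (hq i).ne_zero⟩
    have : Finite (DirectSum ι fun i => ZMod (q i ^ e i)) :=
      Finite.of_equiv _ DFinsupp.equivFunOnFintype.symm
    have : Finite (Additive χ.range) := Finite.of_equiv _ E.symm.toEquiv
    have : Finite χ.range := this
    infer_instance
  · let f : Additive χ.range →+ ℝ := (Int.castAddHom ℝ).comp
      ((Finsupp.applyAddHom 0).comp ((AddMonoidHom.fst _ _).comp E.toAddMonoidHom))
    let φ : Γ →* Multiplicative ℝ := MonoidHom.mk'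
      (fun γ => Multiplicative.ofAdd (f (Additive.ofMul (χ.rangeRestrict γ))))
      (fun a b => by rw [map_mul, ofMul_mul, map_add, ofAdd_add])
    obtain ⟨b, hb⟩ := E.surjective (Finsupp.single 0 1, 0)
    obtain ⟨γ, hγ⟩ := χ.rangeRestrict_surjective b.toMul
    have h0 : f (Additive.ofMul (χ.rangeRestrict γ)) = 0 :=
      Multiplicative.ofAdd.injective (DFunLike.congr_fun (htriv φ) γ)
    rw [hγ, ofMul_toMul] at h0
    have h1 : f b = (((E b).1 0 : ℤ) : ℝ) := rfl
    rw [h1, hb] at h0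
    simp at h0

theorem UnitAddCircle.coe_eq_coe_iff {a b : ℝ} :
    (a : UnitAddCircle) = b ↔ ∃ n : ℤ, a = b + n := by
  rw [← sub_eq_zero, ← AddCircle.coe_sub, AddCircle.coe_eq_zero_iff]
  refine exists_congr fun n => ?_
  rw [zsmul_one]
  constructor <;> intro h <;> linarith

theorem exists_int_eq_add_of_coe_eq {F₁ F₂ : ℝ → ℝ} (h₁ : Continuous F₁) (h₂ : Continuous F₂)
    (h : ∀ x, (F₁ x : UnitAddCircle) = F₂ x) : ∃ n : ℤ, ∀ x, F₁ x = F₂ x + n := by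
  choose n hn using fun x => UnitAddCircle.coe_eq_coe_iff.1 (h x)
  have hc : Continuous n := by
    rw [Int.isClosedEmbedding_coe_real.isInducing.continuous_iff]
    have : ((↑) : ℤ → ℝ) ∘ n = fun x => F₁ x - F₂ x := by
      funext x
      simp [hn x]
    rw [this]
    exact h₁.sub h₂
  refine ⟨n 0, fun x => ?_⟩
  rw [hn x, PreconnectedSpace.constant inferInstance hc (x := x) (y := 0)]

theorem Homeomorph.unitAddCircle_mul_apply (f g : UnitAddCircle ≃ₜ UnitAddCircle)
    (c : UnitAddCircle) : (f * g) c = f (g c) := rfl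

theorem Homeomorph.unitAddCircle_one_apply (c : UnitAddCircle) :
    (1 : UnitAddCircle ≃ₜ UnitAddCircle) c = c := rfl

theorem eq_one_of_fixed_point {Γ : Type*} [Group Γ] (hfg : Group.FG Γ)
    (htriv : ∀ φ : Γ →* Multiplicative ℝ, φ = 1)
    (σ : Γ →* (UnitAddCircle ≃ₜ UnitAddCircle)) (hσ : ∀ γ, ∃ F, IsOPC1Lift (σ γ) F)
    {c : UnitAddCircle} (hc : ∀ γ, σ γ c = c) : σ = 1 := by
  obtain ⟨p, rfl⟩ := QuotientAddGroup.mk_surjective c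
  have hlift : ∀ γ, ∃ F, IsOPC1Lift (σ γ) F ∧ F p = p := by
    intro γ
    obtain ⟨F, hF1, hF2, hF3, hF4⟩ := hσ γ
    obtain ⟨n, hn⟩ := UnitAddCircle.coe_eq_coe_iff.1 ((hF4 p).symm.trans (hc γ))
    refine ⟨fun x => F x - n, ⟨hF1.sub contDiff_const, fun x => ?_, fun x => ?_, fun x => ?_⟩, ?_⟩
    · rw [deriv_sub_const]
      exact hF2 x
    · simp only [hF3]
      ring
    · rw [hF4, UnitAddCircle.coe_eq_coe_iff]
      exact ⟨n, by ring⟩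
    · simp [hn]
  choose ψ hψ hψp using hlift
  have huniq : ∀ {F₁ F₂ : ℝ → ℝ}, Continuous F₁ → Continuous F₂ →
      (∀ x, (F₁ x : UnitAddCircle) = F₂ x) → F₁ p = p → F₂ p = p → ∀ x, F₁ x = F₂ x := by
    intro F₁ F₂ h1 h2 h hp1 hp2 x
    obtain ⟨n, hn⟩ := exists_int_eq_add_of_coe_eq h1 h2 h
    have := hn p
    rw [hn x]
    linarith
  have hcont : ∀ γ, Continuous (ψ γ) := fun γ => (hψ γ).1.continuous
  have hfix := fixed_of_contDiff_of_fixed_point hfg htriv (ψ := ψ) (p := p)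
    (fun a b => huniq (hcont _) ((hcont a).comp (hcont b))
      (fun x => by
        rw [← (hψ (a * b)).2.2.2, ← (hψ a).2.2.2, ← (hψ b).2.2.2, map_mul]
        rfl)
      (hψp _) (by simp [hψp]))
    (huniq (hcont 1) continuous_id
      (fun x => by
        rw [← (hψ 1).2.2.2, map_one]
        rfl) (hψp 1) rfl)
    (fun γ => (hψ γ).1) (fun γ => (hψ γ).2.1) hψp
  ext γ x
  obtain ⟨x, rfl⟩ := QuotientAddGroup.mk_surjective x
  exact ((hψ γ).2.2.2 x).trans (congrArg _ (hfix γ x))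

theorem finiteIndex_ker_of_finiteIndex_fixed_point {G : Type*} [Group G] (hfg : Group.FG G)
    (htriv : ∀ G₀ : Subgroup G, G₀.Normal → G₀.FiniteIndex → ∀ φ : G₀ →* Multiplicative ℝ, φ = 1)
    (σ : G →* (UnitAddCircle ≃ₜ UnitAddCircle)) (N : Subgroup G) [N.FiniteIndex]
    (hN : ∀ g ∈ N, ∃ F, IsOPC1Lift (σ g) F) {c : UnitAddCircle} (hc : ∀ g ∈ N, σ g c = c) :
    σ.ker.FiniteIndex := by
  have h1 : σ.comp N.normalCore.subtype = 1 :=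
    eq_one_of_fixed_point inferInstance (htriv N.normalCore inferInstance inferInstance) _
      (fun γ => hN _ (N.normalCore_le γ.2)) (fun γ => hc _ (N.normalCore_le γ.2))
  exact Subgroup.finiteIndex_of_le (H := N.normalCore) fun g hg =>
    σ.mem_ker.2 (DFunLike.congr_fun h1 ⟨g, hg⟩)

/-- `u` is a lift to the real line of the circle homeomorphism `f`. -/
def IsUnitLift (f : UnitAddCircle ≃ₜ UnitAddCircle) (u : CircleDeg1Liftˣ) : Prop :=
  ∀ x : ℝ, f x = (u x : UnitAddCircle)

namespace CircleDeg1Lift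

theorem continuous_units (u : CircleDeg1Liftˣ) : Continuous u :=
  (toOrderIso u).continuous

theorem strictMono_units (u : CircleDeg1Liftˣ) : StrictMono u :=
  (toOrderIso u).strictMono

/-- A continuous strictly increasing map commuting with the translation by one is invertible. -/
theorem exists_units_of_strictMono {F : ℝ → ℝ} (hc : Continuous F) (hm : StrictMono F)
    (h1 : ∀ x, F (x + 1) = F x + 1) : ∃ u : CircleDeg1Liftˣ, ∀ x, u x = F x := by
  let f : CircleDeg1Lift := ⟨⟨F, hm.monotone⟩, h1⟩
  obtain ⟨u, hu⟩ := isUnit_iff_bijective.2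
    (⟨hm.injective, f.continuous_iff_surjective.1 hc⟩ : Function.Bijective f)
  exact ⟨u, fun x => by rw [hu]; rfl⟩

end CircleDeg1Lift

namespace IsUnitLift

variable {f g : UnitAddCircle ≃ₜ UnitAddCircle} {u v : CircleDeg1Liftˣ}

theorem one : IsUnitLift 1 1 := fun _ => rfl

theorem mul (hu : IsUnitLift f u) (hv : IsUnitLift g v) : IsUnitLift (f * g) (u * v) := fun x => by
  rw [Homeomorph.unitAddCircle_mul_apply, hv, hu]
  rfl

theorem inv (hu : IsUnitLift f u) : IsUnitLift f⁻¹ u⁻¹ := fun x => by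
  have : f (u⁻¹ x : ℝ) = x := by rw [hu, CircleDeg1Lift.units_apply_inv_apply]
  rw [← this]
  exact f.symm_apply_apply _

theorem translate (n : ℤ) :
    IsUnitLift 1 (CircleDeg1Lift.translate (Multiplicative.ofAdd (n : ℝ))) := fun x => by
  rw [CircleDeg1Lift.translate_apply, Homeomorph.unitAddCircle_one_apply,
    UnitAddCircle.coe_eq_coe_iff]
  exact ⟨-n, by push_cast; ring⟩

theorem exists_eq_translate_mul (hu : IsUnitLift f u) (hv : IsUnitLift f v) :
    ∃ n : ℤ, u = CircleDeg1Lift.translate (Multiplicative.ofAdd (n : ℝ)) * v := by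
  obtain ⟨n, hn⟩ := exists_int_eq_add_of_coe_eq (CircleDeg1Lift.continuous_units u)
    (CircleDeg1Lift.continuous_units v) (fun x => (hu x).symm.trans (hv x))
  refine ⟨n, Units.ext (CircleDeg1Lift.ext fun x => ?_)⟩
  rw [Units.val_mul, CircleDeg1Lift.mul_apply, CircleDeg1Lift.translate_apply, hn x, add_comm]

end IsUnitLift

theorem IsOPC1Lift.strictMono {f : UnitAddCircle ≃ₜ UnitAddCircle} {F : ℝ → ℝ}
    (h : IsOPC1Lift f F) : StrictMono F :=
  strictMono_of_deriv_pos h.2.1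

theorem IsOPC1Lift.exists_isUnitLift {f : UnitAddCircle ≃ₜ UnitAddCircle} {F : ℝ → ℝ}
    (h : IsOPC1Lift f F) : ∃ u, IsUnitLift f u := by
  obtain ⟨u, hu⟩ := CircleDeg1Lift.exists_units_of_strictMono h.1.continuous h.strictMono h.2.2.1
  exact ⟨u, fun x => by rw [hu, h.2.2.2]⟩

theorem IsC1Lift.isOPC1Lift_or_strictAnti {f : UnitAddCircle ≃ₜ UnitAddCircle} {F : ℝ → ℝ}
    (h : IsC1Lift f F) :
    IsOPC1Lift f F ∨ (StrictAnti F ∧ ∀ x, F (x + 1) = F x - 1) := by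
  obtain ⟨hC, hne, hper, hlift⟩ := h
  have hdc : Continuous (deriv F) := hC.continuous_deriv le_rfl
  have hsign : (∀ x, 0 < deriv F x) ∨ ∀ x, deriv F x < 0 := by
    by_contra! hcon
    obtain ⟨⟨a, ha⟩, b, hb⟩ := hcon
    obtain ⟨x, hx⟩ := mem_range_of_exists_le_of_exists_ge hdc ⟨a, ha⟩ ⟨b, hb⟩
    exact hne x hx
  rcases hsign with hpos | hneg
  · left
    refine ⟨hC, hpos, hper.resolve_right fun h => ?_, hlift⟩
    have := strictMono_of_deriv_pos hpos (show (0 : ℝ) < 0 + 1 by norm_num)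
    linarith [h 0]
  · right
    refine ⟨strictAnti_of_deriv_neg hneg, hper.resolve_left fun h => ?_⟩
    have := strictAnti_of_deriv_neg hneg (show (0 : ℝ) < 0 + 1 by norm_num)
    linarith [h 0]

/-- An orientation-reversing map does not admit an orientation-preserving lift. -/
theorem IsC1Lift.isOPC1Lift_of_isUnitLift {f : UnitAddCircle ≃ₜ UnitAddCircle} {F : ℝ → ℝ}
    {u : CircleDeg1Liftˣ} (h : IsC1Lift f F) (hu : IsUnitLift f u) : IsOPC1Lift f F := by
  refine h.isOPC1Lift_or_strictAnti.resolve_right fun ⟨_, hF⟩ => ?_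
  obtain ⟨n, hn⟩ := exists_int_eq_add_of_coe_eq h.1.continuous (CircleDeg1Lift.continuous_units u)
    (fun x => (h.2.2.2 x).symm.trans (hu x))
  have h1 := hn (0 + 1)
  rw [CircleDeg1Lift.map_add_one, hF, hn 0] at h1
  linarith

theorem IsC1Action.exists_normal_finiteIndex {G : Type*} [Group G]
    {σ : G →* (UnitAddCircle ≃ₜ UnitAddCircle)} (hσ : IsC1Action σ) :
    ∃ N : Subgroup G, N.Normal ∧ N.FiniteIndex ∧ ∀ g ∈ N, ∃ F, IsOPC1Lift (σ g) F := by
  let S : Subgroup G :=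
    { carrier := {g | ∃ u, IsUnitLift (σ g) u}
      one_mem' := ⟨1, by rw [map_one]; exact IsUnitLift.one⟩
      mul_mem' := fun ⟨u, hu⟩ ⟨v, hv⟩ => ⟨u * v, by rw [map_mul]; exact hu.mul hv⟩
      inv_mem' := fun ⟨u, hu⟩ => ⟨u⁻¹, by rw [map_inv]; exact hu.inv⟩ }
  have hSC : ∀ g ∈ S, ∃ F, IsOPC1Lift (σ g) F := by
    rintro g ⟨u, hu⟩
    obtain ⟨F, hF⟩ := hσ g
    exact ⟨F, hF.isOPC1Lift_of_isUnitLift hu⟩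
  have hmul : ∀ a b, a ∉ S → b ∉ S → a * b ∈ S := by
    intro a b ha hb
    obtain ⟨A, hA⟩ := hσ a
    obtain ⟨B, hB⟩ := hσ b
    obtain ⟨hA1, hA2⟩ := hA.isOPC1Lift_or_strictAnti.resolve_left
      fun h => ha h.exists_isUnitLift
    obtain ⟨hB1, hB2⟩ := hB.isOPC1Lift_or_strictAnti.resolve_left
      fun h => hb h.exists_isUnitLift
    obtain ⟨u, hu⟩ := CircleDeg1Lift.exists_units_of_strictMono
      (hA.1.continuous.comp hB.1.continuous) (hA1.comp hB1) (fun x => by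
        have := hA2 (B x - 1)
        rw [sub_add_cancel] at this
        simp only [Function.comp_apply, hB2]
        linarith)
    refine ⟨u, fun x => ?_⟩
    rw [map_mul, Homeomorph.unitAddCircle_mul_apply, hB.2.2.2, hA.2.2.2, hu]
    rfl
  have hfin : S.FiniteIndex := by
    by_cases hS : ∃ a, a ∉ S
    · obtain ⟨a, ha⟩ := hS
      have hcover : (Set.univ : Set (G ⧸ S)) ⊆ {((1 : G) : G ⧸ S), (a : G ⧸ S)} := by
        intro q _
        obtain ⟨b, rfl⟩ := QuotientGroup.mk_surjective q
        by_cases hb : b ∈ S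
        · left
          exact QuotientGroup.eq.2 (by simpa using hb)
        · right
          exact QuotientGroup.eq.2 (hmul _ _ (fun h => hb (S.inv_mem_iff.1 h)) ha)
      have : Finite (G ⧸ S) := Set.finite_univ_iff.1 ((Set.toFinite _).subset hcover)
      exact Subgroup.finiteIndex_of_finite_quotient
    · push Not at hS
      rw [(Subgroup.eq_top_iff' S).2 hS]
      infer_instance
  exact ⟨S.normalCore, inferInstance, inferInstance, fun g hg => hSC g (S.normalCore_le hg)⟩

namespace CircleDeg1Lift

/-- The translation by an integer, as a lift of the identity of the circle. -/
abbrev translateInt (n : ℤ) : CircleDeg1Liftˣ := translate (Multiplicative.ofAdd (n : ℝ))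

theorem units_mul_apply (u v : CircleDeg1Liftˣ) (x : ℝ) : (u * v) x = u (v x) := rfl

/-- If two nonempty closed sets invariant under a group of lifts are disjoint, then the group has
a finite orbit on the circle. -/
theorem exists_finite_orbit_of_disjoint {M : Subgroup CircleDeg1Liftˣ}
    (hM : ∀ n : ℤ, translateInt n ∈ M) {A B : Set ℝ}
    (hA : IsClosed A) (hB : IsClosed B) (hAne : A.Nonempty) (hBne : B.Nonempty)
    (hAM : ∀ u ∈ M, ∀ x ∈ A, u x ∈ A) (hBM : ∀ u ∈ M, ∀ x ∈ B, u x ∈ B) (hAB : Disjoint A B) :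
    ∃ e : ℝ, (Set.range fun u : M => ((u : CircleDeg1Liftˣ) e : UnitAddCircle)).Finite := by
  set E : Set ℝ := {a | ∃ b ∈ B, IsGreatest (A ∩ Set.Iic b) a} with hE
  have hEM : ∀ u ∈ M, ∀ a ∈ E, u a ∈ E := by
    rintro u hu a ⟨b, hb, ⟨haA, hab⟩, hmax⟩
    refine ⟨u b, hBM u hu b hb, ⟨hAM u hu a haA, (u : CircleDeg1Lift).monotone hab⟩, ?_⟩
    rintro a' ⟨ha'A, ha'b⟩
    have h1 : u⁻¹ a' ≤ a := by
      refine hmax ⟨hAM _ (M.inv_mem hu) _ ha'A, ?_⟩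
      have := (u⁻¹ : CircleDeg1Liftˣ).val.monotone ha'b
      rwa [units_inv_apply_apply] at this
    have := (u : CircleDeg1Lift).monotone h1
    rwa [units_apply_inv_apply] at this
  have hEne : E.Nonempty := by
    obtain ⟨a, ha⟩ := hAne
    obtain ⟨b, hb⟩ := hBne
    obtain ⟨n, hn⟩ := exists_int_gt (a - b)
    have hne : (A ∩ Set.Iic b).Nonempty := by
      refine ⟨translateInt (-n) a, hAM _ (hM _) _ ha, ?_⟩
      rw [Set.mem_Iic, translate_apply]
      push_cast
      linarith
    have hbdd : BddAbove (A ∩ Set.Iic b) := ⟨b, fun _ h => h.2⟩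
    exact ⟨_, b, hb, (hA.inter isClosed_Iic).csSup_mem hne hbdd, fun _ h => le_csSup hbdd h⟩
  have hsep : ∃ r : ℝ, 0 < r ∧ ∀ x ∈ E ∩ Set.Icc 0 1, ∀ y ∈ E, x < y → r < y - x := by
    obtain ⟨r, hr, h⟩ := Metric.exists_pos_forall_lt_edist
      ((isCompact_Icc (a := (0 : ℝ)) (b := 1)).inter_left hA) hB
      (hAB.mono_left Set.inter_subset_left)
    refine ⟨r, hr, ?_⟩
    rintro x ⟨⟨b, hb, ⟨hxA, hxb⟩, hmax⟩, hx01⟩ y ⟨_, _, ⟨hyA, _⟩, _⟩ hxy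
    have hby : b < y := by
      by_contra! hyb
      exact absurd (hmax ⟨hyA, hyb⟩) (not_le.2 hxy)
    have h1 := h x ⟨hxA, hx01⟩ b hb
    rw [edist_nndist, ENNReal.coe_lt_coe, ← NNReal.coe_lt_coe, coe_nndist, dist_comm,
      Real.dist_eq, abs_of_nonneg (sub_nonneg.2 hxb)] at h1
    linarith
  obtain ⟨r, hr, hsep⟩ := hsep
  have hfin : (E ∩ Set.Icc 0 1).Finite := by
    refine Set.Finite.of_finite_image (f := fun x => ⌊x / r⌋)
      ((Set.finite_Icc (0 : ℤ) ⌊1 / r⌋).subset ?_) ?_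
    · rintro _ ⟨x, ⟨-, hx0, hx1⟩, rfl⟩
      exact ⟨Int.floor_nonneg.2 (by positivity), Int.floor_le_floor (by gcongr)⟩
    · intro x hx y hy hxy
      have h1 : |x - y| < r := by
        have := Int.abs_sub_lt_one_of_floor_eq_floor hxy
        rwa [← sub_div, abs_div, abs_of_pos hr, div_lt_one hr] at this
      rw [abs_lt] at h1
      by_contra hne
      rcases lt_or_gt_of_ne hne with h | h
      · linarith [hsep x hx y hy.1 h]
      · linarith [hsep y hy x hx.1 h]
  obtain ⟨e, he⟩ := hEne
  refine ⟨e, (hfin.image ((↑) : ℝ → UnitAddCircle)).subset ?_⟩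
  rintro _ ⟨⟨u, hu⟩, rfl⟩
  refine ⟨translateInt (-⌊u e⌋) (u e), ⟨hEM _ (hM _) _ (hEM u hu e he), ?_⟩, ?_⟩
  · have h0 := Int.floor_le (u e)
    have h1 := Int.lt_floor_add_one (u e)
    rw [translate_apply]
    push_cast
    constructor <;> linarith
  · rw [translate_apply]
    exact UnitAddCircle.coe_eq_coe_iff.2 ⟨-⌊u e⌋, by push_cast; ring⟩

theorem iInter_nonempty_of_forall_infinite_orbit {M : Subgroup CircleDeg1Liftˣ}
    (hM : ∀ n : ℤ, translateInt n ∈ M)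
    (horb : ∀ e : ℝ, ¬ (Set.range fun u : M => ((u : CircleDeg1Liftˣ) e : UnitAddCircle)).Finite)
    {ι : Type*} {A : ι → Set ℝ} (hA : ∀ i, IsClosed (A i)) (hne : ∀ i, (A i).Nonempty)
    (hAM : ∀ i, ∀ u ∈ M, ∀ x ∈ A i, u x ∈ A i) : (⋂ i, A i).Nonempty := by
  classical
  have hinv : ∀ t : Finset ι, ∀ u ∈ M, ∀ x ∈ ⋂ i ∈ t, A i, u x ∈ ⋂ i ∈ t, A i := by
    intro t u hu x hx
    simp only [Set.mem_iInter] at hx ⊢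
    exact fun i hi => hAM i u hu x (hx i hi)
  have hfinite : ∀ t : Finset ι, (⋂ i ∈ t, A i).Nonempty := by
    intro t
    induction t using Finset.induction_on with
    | empty => simp
    | insert i t _ ih =>
      rw [Finset.set_biInter_insert, ← Set.not_disjoint_iff_nonempty_inter]
      intro hdisj
      obtain ⟨e, he⟩ := exists_finite_orbit_of_disjoint hM (hA i)
        (isClosed_biInter fun i _ => hA i) (hne i) ih (hAM i) (hinv t) hdisj
      exact horb e he
  have := (isCompact_Icc (a := (0 : ℝ)) (b := 1)).inter_iInter_nonempty A hA fun t => by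
    obtain ⟨x, hx⟩ := hfinite t
    refine ⟨translateInt (-⌊x⌋) x, ?_, hinv t _ (hM _) x hx⟩
    have h0 := Int.floor_le x
    have h1 := Int.lt_floor_add_one x
    rw [translate_apply]
    push_cast
    constructor <;> linarith
  exact this.mono Set.inter_subset_right

/-- If all elements of translation number zero in a group of lifts have a common fixed point, then
the translation number is additive on that group. -/
theorem translationNumber_mul_of_common_fixed_point {L : Subgroup CircleDeg1Liftˣ} {x₀ : ℝ}
    (hx₀ : ∀ u ∈ L, translationNumber u = 0 → u x₀ = x₀) {a b : CircleDeg1Liftˣ}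
    (ha : a ∈ L) (hb : b ∈ L) :
    translationNumber ↑(a * b) = translationNumber a + translationNumber b := by
  set K : Set ℝ := {x | ∀ u ∈ L, translationNumber u = 0 → u x = x} with hK
  have hKL : ∀ v ∈ L, ∀ x ∈ K, v x ∈ K := by
    intro v hv x hx u hu hu0
    have h1 := hx (v⁻¹ * u * v) (L.mul_mem (L.mul_mem (L.inv_mem hv) hu) hv) (by
      rw [Units.val_mul, Units.val_mul, translationNumber_conj_eq', hu0])
    rw [units_mul_apply, units_mul_apply] at h1
    have h2 := congrArg v h1
    rwa [units_apply_inv_apply] at h2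
  have hsign : ∀ u ∈ L, ∀ x ∈ K, u x ≤ x ↔ translationNumber u ≤ 0 := by
    intro u hu x hx
    constructor
    · intro h
      simpa using translationNumber_le_of_le_add_int (u : CircleDeg1Lift) (x := x) (m := 0)
        (by simpa using h)
    · intro h
      rcases h.lt_or_eq with h | h
      · have := map_lt_of_translationNumber_lt_int (u : CircleDeg1Lift) (n := 0)
          (by simpa using h) x
        simpa using this.le
      · exact (hx u hu h).le
  have htotal : ∀ u ∈ L, ∀ v ∈ L, (∀ x ∈ K, u x ≤ v x) ∨ ∀ x ∈ K, v x ≤ u x := by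
    have key : ∀ u ∈ L, ∀ v ∈ L, ∀ x ∈ K, u x ≤ v x ↔ translationNumber ↑(v⁻¹ * u) ≤ 0 := by
      intro u hu v hv x hx
      rw [← hsign _ (L.mul_mem (L.inv_mem hv) hu) x hx, units_mul_apply,
        ← (strictMono_units v).le_iff_le (a := v⁻¹ (u x)), units_apply_inv_apply]
    intro u hu v hv
    by_cases h : translationNumber ↑(v⁻¹ * u) ≤ 0
    · exact Or.inl fun x hx => (key u hu v hv x hx).2 h
    · exact Or.inr fun x hx => le_of_not_ge fun h' => h ((key u hu v hv x hx).1 h')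
  have hpowL : ∀ u ∈ L, ∀ n : ℕ, u ^ n ∈ L := fun u hu n => L.pow_mem hu n
  have hmono : ∀ u ∈ L, ∀ v ∈ L, (∀ x ∈ K, u x ≤ v x) →
      translationNumber u ≤ translationNumber v := by
    intro u hu v hv h
    have hpow : ∀ n : ℕ, (u ^ n) x₀ ≤ (v ^ n) x₀ := by
      intro n
      induction n with
      | zero => simp
      | succ n ih =>
        rw [pow_succ', pow_succ', units_mul_apply, units_mul_apply]
        exact (h _ (hKL _ (hpowL u hu n) _ hx₀)).trans ((v : CircleDeg1Lift).monotone ih)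
    refine le_of_tendsto_of_tendsto' (tendsto_translationNumber (u : CircleDeg1Lift) x₀)
      (tendsto_translationNumber (v : CircleDeg1Lift) x₀) fun n => ?_
    have := hpow n
    rw [Units.val_pow_eq_pow_val, Units.val_pow_eq_pow_val] at this
    gcongr
  let R : CircleDeg1Liftˣ → CircleDeg1Liftˣ → Prop := fun u v => ∀ x ∈ K, u x ≤ v x
  have hRtrans : ∀ {u v w}, R u v → R v w → R u w := fun h h' x hx => (h x hx).trans (h' x hx)
  have hRleft : ∀ {u v} w, R u v → R (w * u) (w * v) := fun w h x hx =>
    (w : CircleDeg1Lift).monotone (h x hx)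
  have hRright : ∀ {u v w}, w ∈ L → R u v → R (u * w) (v * w) := fun hw h x hx =>
    h _ (hKL _ hw x hx)
  have hpows : ∀ a ∈ L, ∀ b ∈ L, R (a * b) (b * a) →
      ∀ n : ℕ, R (a ^ n * b ^ n) ((a * b) ^ n) ∧ R ((a * b) ^ n) (b ^ n * a ^ n) := by
    intro a ha b hb hab n
    have hswap : ∀ n : ℕ, R (a ^ n * b) (b * a ^ n) := by
      intro n
      induction n with
      | zero => simp [R]
      | succ n ih =>
        have h1 := hRleft a ih
        have h2 := hRright (hpowL a ha n) hab
        have h3 := hRtrans (by simpa only [mul_assoc] using h1) (by simpa only [mul_assoc] using h2)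
        simpa only [pow_succ', mul_assoc] using h3
    induction n with
    | zero => simp [R]
    | succ n ih =>
      constructor
      · have h1 := hRleft a (hRright (hpowL b hb n) (hswap n))
        have h2 := hRleft (a * b) ih.1
        have h3 := hRtrans (by simpa only [mul_assoc] using h1) (by simpa only [mul_assoc] using h2)
        rw [pow_succ a, pow_succ' b, pow_succ' (a * b)]
        have h4 : a ^ n * a = a * a ^ n := (pow_succ a n).symm.trans (pow_succ' a n)
        rw [h4]
        simpa only [mul_assoc] using h3
      · have h1 := hRright (L.mul_mem ha hb) ih.2
        have h2 := hRleft (b ^ n) (hswap (n + 1))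
        have h3 := hRtrans (by simpa only [pow_succ, mul_assoc] using h1)
          (by simpa only [pow_succ, mul_assoc] using h2)
        simpa only [pow_succ, mul_assoc] using h3
  have hswapτ : ∀ f g : CircleDeg1Liftˣ, translationNumber ↑(f * g) = translationNumber ↑(g * f) := by
    intro f g
    rw [← translationNumber_conj_eq f ↑(g * f), ← Units.val_mul, ← Units.val_mul]
    group
  have hpow_eq : ∀ n : ℕ,
      translationNumber ↑((a * b) ^ n) = translationNumber ↑(a ^ n * b ^ n) := by
    intro n
    have hab := L.mul_mem ha hb
    have hba := L.mul_mem hb ha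
    have hanbn := L.mul_mem (hpowL a ha n) (hpowL b hb n)
    have hbnan := L.mul_mem (hpowL b hb n) (hpowL a ha n)
    rcases htotal _ hab _ hba with h | h
    · obtain ⟨h1, h2⟩ := hpows a ha b hb h n
      refine le_antisymm ?_ (hmono _ hanbn _ (hpowL _ hab n) h1)
      rw [hswapτ (a ^ n)]
      exact hmono _ (hpowL _ hab n) _ hbnan h2
    · obtain ⟨h1, h2⟩ := hpows b hb a ha h n
      have h3 : translationNumber ↑((a * b) ^ n) = translationNumber ↑((b * a) ^ n) := by
        rw [Units.val_pow_eq_pow_val, Units.val_pow_eq_pow_val, translationNumber_pow,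
          translationNumber_pow, hswapτ]
      rw [h3]
      refine le_antisymm (hmono _ (hpowL _ hba n) _ hanbn h2) ?_
      rw [hswapτ (a ^ n)]
      exact hmono _ hbnan _ (hpowL _ hba n) h1
  have hquasi : ∀ f g : CircleDeg1Lift,
      |translationNumber (f * g) - translationNumber f - translationNumber g| ≤ 4 := by
    intro f g
    have h1 := dist_map_zero_translationNumber_le (f * g)
    have h2 := dist_map_zero_translationNumber_le f
    have h3 := dist_map_zero_translationNumber_le g
    have h4 := dist_map_map_zero_lt f g
    rw [Real.dist_eq, abs_le] at h1 h2 h3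
    rw [Real.dist_eq, abs_lt] at h4
    rw [mul_apply] at h1
    rw [abs_le]
    constructor <;> linarith
  have hbound : ∀ n : ℕ, n * |translationNumber ↑(a * b) - translationNumber a -
      translationNumber b| ≤ 4 := by
    intro n
    have h := hquasi ↑(a ^ n) ↑(b ^ n)
    rw [← Units.val_mul, ← hpow_eq n] at h
    simp only [Units.val_pow_eq_pow_val, translationNumber_pow] at h
    rwa [← mul_sub, ← mul_sub, abs_mul, Nat.abs_cast] at h
  by_contra hne
  have hpos : 0 < |translationNumber ↑(a * b) - translationNumber a - translationNumber b| := by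
    rw [abs_pos, sub_sub]
    exact sub_ne_zero.2 hne
  obtain ⟨n, hn⟩ := exists_nat_gt (4 / |translationNumber ↑(a * b) - translationNumber a -
    translationNumber b|)
  rw [div_lt_iff₀ hpos] at hn
  exact absurd (hbound n) (not_le.2 hn)

end CircleDeg1Lift

/-- The group of all lifts to the real line of the elements of a group of circle
homeomorphisms. -/
def liftSubgroup {Γ : Type*} [Group Γ] (σ : Γ →* (UnitAddCircle ≃ₜ UnitAddCircle)) :
    Subgroup CircleDeg1Liftˣ where
  carrier := {u | ∃ γ, IsUnitLift (σ γ) u}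
  one_mem' := ⟨1, by rw [map_one]; exact IsUnitLift.one⟩
  mul_mem' := fun ⟨a, ha⟩ ⟨b, hb⟩ => ⟨a * b, by rw [map_mul]; exact ha.mul hb⟩
  inv_mem' := fun ⟨a, ha⟩ => ⟨a⁻¹, by rw [map_inv]; exact ha.inv⟩

theorem translateInt_mem_liftSubgroup {Γ : Type*} [Group Γ]
    (σ : Γ →* (UnitAddCircle ≃ₜ UnitAddCircle)) (n : ℤ) :
    CircleDeg1Lift.translateInt n ∈ liftSubgroup σ :=
  ⟨1, by rw [map_one]; exact IsUnitLift.translate n⟩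

theorem exists_finiteIndex_fixing_of_finite_range {Γ : Type*} [Group Γ]
    (σ : Γ →* (UnitAddCircle ≃ₜ UnitAddCircle)) {c : UnitAddCircle}
    (hc : (Set.range fun γ => σ γ c).Finite) :
    ∃ N : Subgroup Γ, N.FiniteIndex ∧ ∀ γ ∈ N, σ γ c = c := by
  let act : MulAction Γ UnitAddCircle :=
    { smul := fun γ c => σ γ c
      one_smul := fun c => by
        change σ 1 c = c
        rw [map_one]
        rfl
      mul_smul := fun a b c => by
        change σ (a * b) c = σ a (σ b c)
        rw [map_mul]
        rfl }
  have : Finite (MulAction.orbit Γ c) := hc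
  have : Finite (Γ ⧸ MulAction.stabilizer Γ c) :=
    Finite.of_equiv _ (MulAction.orbitEquivQuotientStabilizer Γ c)
  exact ⟨MulAction.stabilizer Γ c, Subgroup.finiteIndex_of_finite_quotient, fun _ h => h⟩

/-- If the elements of translation number zero among all lifts of an action have a common fixed
point, then a finite-index subgroup fixes a point of the circle. -/
theorem exists_finiteIndex_fixing_of_common_fixed_point {Γ : Type*} [Group Γ]
    (hfg : Group.FG Γ) (htriv : ∀ φ : Γ →* Multiplicative ℝ, φ = 1)
    (σ : Γ →* (UnitAddCircle ≃ₜ UnitAddCircle)) (hσ : ∀ γ, ∃ u, IsUnitLift (σ γ) u) {x : ℝ}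
    (hx : ∀ u ∈ liftSubgroup σ, CircleDeg1Lift.translationNumber u = 0 → u x = x) :
    ∃ N : Subgroup Γ, N.FiniteIndex ∧ ∀ γ ∈ N, σ γ x = x := by
  have hadd : ∀ u ∈ liftSubgroup σ, ∀ v ∈ liftSubgroup σ,
      CircleDeg1Lift.translationNumber ↑(u * v) =
        CircleDeg1Lift.translationNumber u + CircleDeg1Lift.translationNumber v :=
    fun u hu v hv => CircleDeg1Lift.translationNumber_mul_of_common_fixed_point hx hu hv
  choose u hu using hσ
  have huL : ∀ γ, u γ ∈ liftSubgroup σ := fun γ => ⟨γ, hu γ⟩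
  let χ : Γ →* Multiplicative UnitAddCircle := MonoidHom.mk'
    (fun γ => Multiplicative.ofAdd (CircleDeg1Lift.translationNumber (u γ) : UnitAddCircle))
    (fun a b => by
      have hab : IsUnitLift (σ (a * b)) (u a * u b) := by
        rw [map_mul]
        exact (hu a).mul (hu b)
      obtain ⟨n, hn⟩ := (hu (a * b)).exists_eq_translate_mul hab
      rw [hn, hadd _ (translateInt_mem_liftSubgroup σ n) _
        ((liftSubgroup σ).mul_mem (huL a) (huL b)), hadd _ (huL a) _ (huL b),
        CircleDeg1Lift.translationNumber_translate, ← ofAdd_add, ← AddCircle.coe_add]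
      exact congrArg _ (UnitAddCircle.coe_eq_coe_iff.2 ⟨n, by ring⟩))
  refine ⟨χ.ker, χ.finiteIndex_ker_of_forall_hom_real_trivial hfg htriv, fun γ hγ => ?_⟩
  have h0 : (CircleDeg1Lift.translationNumber (u γ) : UnitAddCircle) = (0 : ℝ) :=
    Multiplicative.ofAdd.injective (χ.mem_ker.1 hγ)
  obtain ⟨n, hn⟩ := UnitAddCircle.coe_eq_coe_iff.1 h0
  have hT := translateInt_mem_liftSubgroup σ (-n)
  have hfix := hx _ ((liftSubgroup σ).mul_mem hT (huL γ)) (by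
    rw [hadd _ hT _ (huL γ), CircleDeg1Lift.translationNumber_translate, hn]
    push_cast
    ring)
  rw [CircleDeg1Lift.units_mul_apply, CircleDeg1Lift.translate_apply] at hfix
  rw [hu γ, UnitAddCircle.coe_eq_coe_iff]
  refine ⟨n, ?_⟩
  push_cast at hfix
  linarith

/-- The fixed point set of a lift of translation number zero is invariant under every lift of a
commuting homeomorphism. -/
theorem IsUnitLift.map_fixed_of_commute {f g : UnitAddCircle ≃ₜ UnitAddCircle}
    {u v : CircleDeg1Liftˣ} (hu : IsUnitLift f u) (hv : IsUnitLift g v)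
    (hfg : ∀ c, f (g c) = g (f c)) (hu0 : CircleDeg1Lift.translationNumber u = 0) {x : ℝ}
    (hx : u x = x) : u (v x) = v x := by
  have h : ((u (v x) : ℝ) : UnitAddCircle) = (v x : ℝ) := by
    rw [← hu, ← hv, hfg, hu, hx]
  obtain ⟨n, hn⟩ := UnitAddCircle.coe_eq_coe_iff.1 h
  have h1 := CircleDeg1Lift.translationNumber_of_eq_add_int (u : CircleDeg1Lift) hn
  rw [hn, ← h1, hu0, add_zero]

/-- For two commuting actions on the circle, a finite-index subgroup of one of the groups fixes a
point. -/
theorem exists_finiteIndex_fixing_of_commute {P Q : Type*} [Group P] [Group Q]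
    (hfg : Group.FG Q) (htriv : ∀ φ : Q →* Multiplicative ℝ, φ = 1)
    (σ : P →* (UnitAddCircle ≃ₜ UnitAddCircle)) (θ : Q →* (UnitAddCircle ≃ₜ UnitAddCircle))
    (hσ : ∀ p, ∃ u, IsUnitLift (σ p) u) (hθ : ∀ q, ∃ u, IsUnitLift (θ q) u)
    (hcomm : ∀ p q c, θ q (σ p c) = σ p (θ q c)) :
    (∃ c : UnitAddCircle, ∃ N : Subgroup P, N.FiniteIndex ∧ ∀ p ∈ N, σ p c = c) ∨
      ∃ c : UnitAddCircle, ∃ N : Subgroup Q, N.FiniteIndex ∧ ∀ q ∈ N, θ q c = c := by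
  by_cases horb : ∃ e : ℝ, (Set.range fun u : liftSubgroup σ =>
      ((u : CircleDeg1Liftˣ) e : UnitAddCircle)).Finite
  · left
    obtain ⟨e, he⟩ := horb
    refine ⟨e, exists_finiteIndex_fixing_of_finite_range σ (he.subset ?_)⟩
    rintro _ ⟨p, rfl⟩
    obtain ⟨u, hu⟩ := hσ p
    exact ⟨⟨u, p, hu⟩, (hu e).symm⟩
  · right
    push Not at horb
    obtain ⟨x, hx⟩ := CircleDeg1Lift.iInter_nonempty_of_forall_infinite_orbit
      (translateInt_mem_liftSubgroup σ) horb
      (ι := {u : CircleDeg1Liftˣ // u ∈ liftSubgroup θ ∧ CircleDeg1Lift.translationNumber u = 0})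
      (A := fun u => {x | (u : CircleDeg1Liftˣ) x = x})
      (fun u => isClosed_eq (CircleDeg1Lift.continuous_units u) continuous_id)
      (fun u => by
        obtain ⟨x, hx⟩ := (CircleDeg1Lift.translationNumber_eq_int_iff
          ((u : CircleDeg1Liftˣ) : CircleDeg1Lift) (CircleDeg1Lift.continuous_units u)
          (m := 0)).1 (by simpa using u.2.2)
        exact ⟨x, by simpa using hx⟩)
      (by
        rintro ⟨u, ⟨q, hu⟩, hu0⟩ v ⟨p, hv⟩ x hx
        exact hu.map_fixed_of_commute hv (hcomm p q) hu0 hx)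
    refine ⟨x, exists_finiteIndex_fixing_of_common_fixed_point hfg htriv θ hθ fun u hu hu0 => ?_⟩
    exact Set.mem_iInter.1 hx ⟨u, hu, hu0⟩

/-- **Theorem (main 2).** If `H` and `G` are finitely generated groups such that
every finite-index normal subgroup of each has only the trivial homomorphism to
`(ℝ,+)`, then for any `C¹` action of `H × G` on the circle, the induced action
of one of the two factors factors through a finite group. -/
theorem c1_action_of_product_factors_through_finite_on_a_factor
    {H G : Type*} [Group H] [Group G]
    (hHfg : Group.FG H) (hGfg : Group.FG G)
    (hH : ∀ H₀ : Subgroup H, H₀.Normal → H₀.FiniteIndex →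
      ∀ φ : H₀ →* Multiplicative ℝ, φ = 1)
    (hG : ∀ G₀ : Subgroup G, G₀.Normal → G₀.FiniteIndex →
      ∀ φ : G₀ →* Multiplicative ℝ, φ = 1)
    (ρ : (H × G) →* (UnitAddCircle ≃ₜ UnitAddCircle))
    (hρ : IsC1Action ρ) :
    (MonoidHom.ker (ρ.comp (MonoidHom.inl H G))).FiniteIndex ∨
      (MonoidHom.ker (ρ.comp (MonoidHom.inr H G))).FiniteIndex := by
  set σ := ρ.comp (MonoidHom.inl H G) with hσ
  set θ := ρ.comp (MonoidHom.inr H G) with hθ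
  have hσC : IsC1Action σ := fun h => hρ (h, 1)
  have hθC : IsC1Action θ := fun g => hρ (1, g)
  have hcomm : ∀ h g c, θ g (σ h c) = σ h (θ g c) := by
    intro h g c
    change (ρ (1, g) * ρ (h, 1)) c = (ρ (h, 1) * ρ (1, g)) c
    rw [← map_mul, ← map_mul]
    simp
  obtain ⟨P, hPn, hPf, hP⟩ := hσC.exists_normal_finiteIndex
  obtain ⟨Q, hQn, hQf, hQ⟩ := hθC.exists_normal_finiteIndex
  rcases exists_finiteIndex_fixing_of_commute inferInstance (hG Q hQn hQf)
    (σ.comp P.subtype) (θ.comp Q.subtype)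
    (fun p => (hP p p.2).elim fun _ hF => hF.exists_isUnitLift)
    (fun q => (hQ q q.2).elim fun _ hF => hF.exists_isUnitLift)
    (fun p q c => hcomm p q c) with ⟨c, N, hN, hfix⟩ | ⟨c, N, hN, hfix⟩
  · left
    have : (N.map P.subtype).FiniteIndex := ⟨by
      rw [Subgroup.index_map_subtype]
      exact mul_ne_zero hN.index_ne_zero hPf.index_ne_zero⟩
    refine finiteIndex_ker_of_finiteIndex_fixed_point hHfg hH σ (N.map P.subtype) ?_ (c := c) ?_
    · rintro _ ⟨p, -, rfl⟩
      exact hP p p.2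
    · rintro _ ⟨p, hp, rfl⟩
      exact hfix p hp
  · right
    have : (N.map Q.subtype).FiniteIndex := ⟨by
      rw [Subgroup.index_map_subtype]
      exact mul_ne_zero hN.index_ne_zero hQf.index_ne_zero⟩
    refine finiteIndex_ker_of_finiteIndex_fixed_point hGfg hG θ (N.map Q.subtype) ?_ (c := c) ?_
    · rintro _ ⟨q, -, rfl⟩
      exact hQ q q.2
    · rintro _ ⟨q, hq, rfl⟩
      exact hfix q hq
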